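/- Let T be a triangulated category with arbitrary small coproducts, P a compact generator of T, and suppose Λ is N-sparse. Then every object X of T with proj dim π_*X ≤ 1 splits as a coproduct X ≅ ⨁_{i ∈ ℤ/N} X^{(i)}, where for each i ∈ ℤ/N the graded Λ-module π_*X^{(i)} lies in B[i]. -/

import Mathlib

/-!
Shared setup: a triangulated category `C` with (co)products, a compact generator `P`,
the graded endomorphism ring `Λ = End_T(P)_* = Hom_T(Σ^* P, P)` and its category of
graded right modules, realized concretely.
-/

set_option linter.unusedSectionVars false

open CategoryTheory CategoryTheory.Limits CategoryTheory.Pretriangulated DirectSum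

universe v u

namespace Franke

variable {C : Type u} [Category.{v} C] [Preadditive C] [HasZeroObject C]
  [HasShift C ℤ] [∀ n : ℤ, (shiftFunctor C n).Additive] [Pretriangulated C]

/-- The degree `k` component of the graded endomorphism ring
`Λ = End_T(P)_* = Hom_T(Σ^* P, P)`: its degree `k` part is `Hom(P⟦k⟧, P)`. -/
abbrev lam (P : C) (k : ℤ) : Type v := (P⟦k⟧ ⟶ P)

/-- The right action of a degree `k` element `a : Σᵏ P ⟶ P` of `Λ` on a degree `n`
element `m : Σⁿ P ⟶ X` of the graded hom `π_* X = Hom_T(Σ^* P, X)`; the result is the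
degree `n + k` element `Σ^{n+k} P ≅ (Σᵏ P)⟦n⟧ → Σⁿ P → X`. -/
def gsmulHom (P : C) {X : C} {n k l : ℤ} (h : n + k = l)
    (m : P⟦n⟧ ⟶ X) (a : lam P k) : P⟦l⟧ ⟶ X :=
  (shiftFunctorAdd' C k n l (by omega)).hom.app P ≫ a⟦n⟧' ≫ m

/-- The multiplication of the graded endomorphism ring `Λ = End_T(P)_*`. -/
def gmul (P : C) {j k l : ℤ} (h : j + k = l) (a : lam P j) (b : lam P k) : lam P l :=
  gsmulHom P h a b

/-- The unit `1 ∈ Λ₀ = Hom(Σ⁰P, P)` of the graded endomorphism ring. -/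
def gone (P : C) : lam P 0 := (shiftFunctorZero C ℤ).hom.app P

/-- A ℤ-graded right module over the graded endomorphism ring `Λ = End_T(P)_*`.
The action is indexed by proofs `n + k = l` in order to avoid transport along
equalities of degrees. -/
structure GradedModule (P : C) where
  M : ℤ → Type v
  [acg : ∀ n, AddCommGroup (M n)]
  smul : ∀ {n k l : ℤ}, n + k = l → M n → lam P k → M l
  smul_addₓ : ∀ {n k l : ℤ} (h : n + k = l) (m : M n) (a b : lam P k),
    smul h m (a + b) = smul h m a + smul h m b
  add_smulₓ : ∀ {n k l : ℤ} (h : n + k = l) (m m' : M n) (a : lam P k),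
    smul h (m + m') a = smul h m a + smul h m' a
  smul_oneₓ : ∀ {n : ℤ} (m : M n), smul (add_zero n) m (gone P) = m
  smul_mulₓ : ∀ {n j k nj jk njk : ℤ} (h₁ : n + j = nj) (h₂ : j + k = jk)
    (h₃ : nj + k = njk) (h₄ : n + jk = njk) (m : M n) (a : lam P j) (b : lam P k),
    smul h₃ (smul h₁ m a) b = smul h₄ m (gmul P h₂ a b)

attribute [instance] GradedModule.acg

/-- The action of a fixed `a : Λₖ` as an additive map `Mₙ →+ M_{n+k}`. -/
def GradedModule.smulAddHom {P : C} (M : GradedModule P) {n k l : ℤ} (h : n + k = l)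
    (a : lam P k) : M.M n →+ M.M l :=
  AddMonoidHom.mk' (fun m => M.smul h m a) (fun m m' => M.add_smulₓ h m m' a)

theorem GradedModule.zero_smulₓ {P : C} (M : GradedModule P) {n k l : ℤ} (h : n + k = l)
    (a : lam P k) : M.smul h (0 : M.M n) a = 0 :=
  map_zero (M.smulAddHom h a)

/-- `π_* X = Hom_T(Σ^* P, X)` as a graded right `Λ`-module. -/
@[reducible] def piMod (P X : C) : GradedModule P where
  M n := P⟦n⟧ ⟶ X
  smul h m a := gsmulHom P h m a
  smul_addₓ h m a b := by
    simp [gsmulHom, Functor.map_add, Preadditive.comp_add, Preadditive.add_comp]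
  add_smulₓ h m m' a := by
    simp [gsmulHom, Preadditive.comp_add]
  smul_oneₓ m := by
    simp only [gsmulHom, gone]
    rw [shiftFunctorAdd'_zero_add_hom_app, ← Functor.map_comp_assoc, Iso.inv_hom_id_app]
    simp
  smul_mulₓ {n j k nj jk njk} h₁ h₂ h₃ h₄ m a b := by
    simp only [gsmulHom, gmul, Functor.map_comp, Category.assoc]
    have nat := ((shiftFunctorAdd' C j n nj (by omega)).hom).naturality b
    dsimp at nat
    rw [reassoc_of% nat]
    rw [← shiftFunctorAdd'_assoc_hom_app_assoc k j n jk nj njk (by omega) (by omega)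
      (by omega) P]


/-- A morphism of graded right `Λ`-modules: a degree-preserving `Λ`-linear additive map. -/
structure GHom {P : C} (M N : GradedModule P) where
  app : ∀ n : ℤ, M.M n →+ N.M n
  app_smul : ∀ {n k l : ℤ} (h : n + k = l) (m : M.M n) (a : lam P k),
    app l (M.smul h m a) = N.smul h (app n m) a

@[ext] theorem GHom.ext {P : C} {M N : GradedModule P} {f g : GHom M N}
    (h : ∀ (n : ℤ) (x : M.M n), f.app n x = g.app n x) : f = g := by
  obtain ⟨fa, _⟩ := f; obtain ⟨ga, _⟩ := g
  congr 1
  funext n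
  exact AddMonoidHom.ext (h n)

/-- The identity morphism of graded modules. -/
def GHom.id {P : C} (M : GradedModule P) : GHom M M :=
  ⟨fun _ => AddMonoidHom.id _, fun _ _ _ => rfl⟩

/-- Composition of morphisms of graded modules. -/
def GHom.comp {P : C} {M N K : GradedModule P} (g : GHom N K) (f : GHom M N) : GHom M K :=
  ⟨fun n => (g.app n).comp (f.app n), fun h m a => by
    simp only [AddMonoidHom.comp_apply, f.app_smul, g.app_smul]⟩

instance {P : C} {M N : GradedModule P} : Zero (GHom M N) :=
  ⟨{ app := fun _ => 0
     app_smul := fun h m a => by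
       show (0 : N.M _) = N.smul h (0 : N.M _) a
       exact (N.zero_smulₓ h a).symm }⟩

@[simp] theorem GHom.zero_app {P : C} {M N : GradedModule P} (n : ℤ) (x : M.M n) :
    (0 : GHom M N).app n x = 0 := rfl

/-- An isomorphism of graded right `Λ`-modules. -/
structure GIso {P : C} (M N : GradedModule P) where
  hom : GHom M N
  inv : GHom N M
  hom_inv_id : inv.comp hom = GHom.id M
  inv_hom_id : hom.comp inv = GHom.id N

/-- The shift `M[k]` of a graded module, with `M[k]ₙ = M_{n-k}`. -/
@[reducible] def gshift {P : C} (k : ℤ) (M : GradedModule P) : GradedModule P where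
  M n := M.M (n - k)
  smul h m a := M.smul (by omega) m a
  smul_addₓ h m a b := M.smul_addₓ _ m a b
  add_smulₓ h m m' a := M.add_smulₓ _ m m' a
  smul_oneₓ m := M.smul_oneₓ m
  smul_mulₓ h₁ h₂ h₃ h₄ m a b := M.smul_mulₓ _ h₂ _ _ m a b

/-- Surjectivity (in each degree) of a morphism of graded modules. -/
def GHom.Surj {P : C} {M N : GradedModule P} (f : GHom M N) : Prop :=
  ∀ n : ℤ, Function.Surjective (f.app n)

/-- A pair of composable morphisms of graded modules `0 → Z → E → B → 0`
forming a short exact sequence. -/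
structure IsShortExact {P : C} {Z E B : GradedModule P} (ι : GHom Z E) (ρ : GHom E B) : Prop where
  mono : ∀ n : ℤ, Function.Injective (ι.app n)
  epi : ∀ n : ℤ, Function.Surjective (ρ.app n)
  exact : ∀ (n : ℤ) (x : E.M n), ρ.app n x = 0 ↔ x ∈ Set.range (ι.app n)

/-- Exactness of `M → N → K` at `N` (including that the composite vanishes). -/
def ExactPair {P : C} {M N K : GradedModule P} (f : GHom M N) (g : GHom N K) : Prop :=
  ∀ (n : ℤ) (x : N.M n), g.app n x = 0 ↔ x ∈ Set.range (f.app n)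

/-- A graded module is projective if every degreewise surjection onto it splits against
any map from it: the usual lifting property. -/
def IsProjective {P : C} (Q : GradedModule P) : Prop :=
  ∀ (A B : GradedModule P) (e : GHom A B), e.Surj →
    ∀ f : GHom Q B, ∃ g : GHom Q A, e.comp g = f

/-- `projDimLE d M` says that the graded module `M` admits a projective resolution of
length at most `d`, i.e. has projective dimension `≤ d`. -/
def projDimLE {P : C} : ℕ → GradedModule P → Prop
  | 0, M => IsProjective M
  | d + 1, M => ∃ (F K : GradedModule P) (ε : GHom F M) (ι : GHom K F),
      IsProjective F ∧ IsShortExact ι ε ∧ projDimLE d K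

/-- `Λ = End_T(P)_*` is `N`-sparse: concentrated in degrees divisible by `N`. -/
def Sparse (P : C) (N : ℕ) : Prop :=
  ∀ k : ℤ, ¬ ((N : ℤ) ∣ k) → ∀ a : lam P k, a = 0

/-- A graded module belongs to `B[i]`: it is concentrated in degrees congruent
to `i` modulo `N`. -/
def InDegrees {P : C} (N : ℕ) (i : ZMod N) (M : GradedModule P) : Prop :=
  ∀ n : ℤ, (n : ZMod N) ≠ i → ∀ x : M.M n, x = 0

/-- The canonical comparison map `⊕ᵢ Hom(P, Xᵢ) → Hom(P, ∐ᵢ Xᵢ)`. -/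
noncomputable def compactComparison [HasCoproducts.{v} C] (P : C) {ι : Type v} (X : ι → C) :
    (⨁ i, (P ⟶ X i)) →+ (P ⟶ ∐ X) := by
  classical
  exact DirectSum.toAddMonoid fun i =>
    AddMonoidHom.mk' (fun f => f ≫ Sigma.ι X i) (fun f g => Preadditive.add_comp _ _ _ _ _ _)

/-- `P` is a compact object: `Hom(P, −)` commutes with small coproducts. -/
def IsCompactObj [HasCoproducts.{v} C] (P : C) : Prop :=
  ∀ (ι : Type v) (X : ι → C), Function.Bijective (compactComparison P X)

/-- `P` is a generator: an object all of whose graded homs from `P` vanish is zero. -/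
def IsGenerator (P : C) : Prop :=
  ∀ X : C, (∀ (n : ℤ) (f : P⟦n⟧ ⟶ X), f = 0) → IsZero X

/-- The morphism of graded modules `π_* f : π_* X → π_* Y` induced by `f : X ⟶ Y`. -/
def piGHom (P : C) {X Y : C} (f : X ⟶ Y) : GHom (piMod P X) (piMod P Y) where
  app n := AddMonoidHom.mk' (fun u => u ≫ f) fun u v => Preadditive.add_comp _ _ _ _ _ _
  app_smul h m a := by
    show (gsmulHom P h m a) ≫ f = gsmulHom P h (m ≫ f) a
    simp [gsmulHom]

/-- An extension of `B` by `Z` in the category of graded right `Λ`-modules: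
  a short exact sequence `0 → Z → E → B → 0`. -/
structure GExtension {P : C} (B Z : GradedModule P) where
  E : GradedModule P
  ι : GHom Z E
  ρ : GHom E B
  shortExact : IsShortExact ι ρ

/-- Two extensions are identified if there is a morphism of extensions between them
(such a morphism is automatically an isomorphism). -/
def GExtension.Rel {P : C} {B Z : GradedModule P} (e e' : GExtension B Z) : Prop :=
  ∃ φ : GHom e.E e'.E, φ.comp e.ι = e'.ι ∧ e'.ρ.comp φ = e.ρ

/-- `Ext¹_Λ(B, Z)`, realized as the set of equivalence classes of extensions
`0 → Z → E → B → 0` of graded right `Λ`-modules. -/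
def Ext1 {P : C} (B Z : GradedModule P) : Type _ :=
  Quot (GExtension.Rel (B := B) (Z := Z))

/-- Given `δ : Cc ⟶ ΣX`, the induced morphism of graded modules
`π_* Cc → (π_* X)[1]`, using the canonical identification `π_*(ΣX) ≅ (π_*X)[1]`. -/
noncomputable def triangleConnect (P : C) {X Cc : C} (δ : Cc ⟶ X⟦(1:ℤ)⟧) :
    GHom (piMod P Cc) (gshift 1 (piMod P X)) where
  app n := AddMonoidHom.mk' (fun u =>
    (shiftFunctorAdd' C n (-1) (n-1) (by omega)).hom.app P ≫ (u ≫ δ)⟦(-1:ℤ)⟧' ≫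
      (shiftFunctorCompIsoId C (1:ℤ) (-1) (by omega)).hom.app X) (fun u v => by
        simp [Preadditive.add_comp, Preadditive.comp_add, Functor.map_add])
  app_smul {n k l} h m a := by
    simp only [AddMonoidHom.mk'_apply]
    show (shiftFunctorAdd' C l (-1) (l-1) (by omega)).hom.app P ≫
        ((gsmulHom P h m a) ≫ δ)⟦(-1:ℤ)⟧' ≫
          (shiftFunctorCompIsoId C (1:ℤ) (-1) (by omega)).hom.app X =
      gsmulHom P (show (n-1) + k = l - 1 by omega)
        ((shiftFunctorAdd' C n (-1) (n-1) (by omega)).hom.app P ≫ (m ≫ δ)⟦(-1:ℤ)⟧' ≫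
          (shiftFunctorCompIsoId C (1:ℤ) (-1) (by omega)).hom.app X) a
    simp only [gsmulHom, Functor.map_comp, Category.assoc]
    have nat := ((shiftFunctorAdd' C n (-1) (n-1) (by omega : n + -1 = n - 1)).hom).naturality a
    dsimp at nat
    rw [reassoc_of% nat]
    rw [shiftFunctorAdd'_assoc_hom_app_assoc k n (-1) l (n-1) (l-1) (by omega) (by omega)
      (by omega) P]

section ExtGroups

instance {P : C} {M N : GradedModule P} : Add (GHom M N) :=
  ⟨fun f g =>
    { app := fun n => f.app n + g.app n
      app_smul := fun {n k l} h m a => by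
        show f.app l _ + g.app l _ = N.smul h (f.app n m + g.app n m) a
        rw [f.app_smul, g.app_smul, N.add_smulₓ] }⟩

instance {P : C} {M N : GradedModule P} : Neg (GHom M N) :=
  ⟨fun f =>
    { app := fun n => -(f.app n)
      app_smul := fun {n k l} h m a => by
        show -(f.app l _) = N.smul h (-(f.app n m)) a
        rw [f.app_smul]
        exact (map_neg (N.smulAddHom h a) _).symm }⟩

@[simp] theorem GHom.add_app {P : C} {M N : GradedModule P} (f g : GHom M N) (n : ℤ)
    (x : M.M n) : (f + g).app n x = f.app n x + g.app n x := rfl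

@[simp] theorem GHom.neg_app {P : C} {M N : GradedModule P} (f : GHom M N) (n : ℤ)
    (x : M.M n) : (-f).app n x = -(f.app n x) := rfl

instance {P : C} {M N : GradedModule P} : AddCommGroup (GHom M N) where
  add := (· + ·)
  zero := 0
  neg := Neg.neg
  add_assoc f g h := by ext n x; simp [add_assoc]
  zero_add f := by ext n x; simp
  add_zero f := by ext n x; simp
  add_comm f g := by ext n x; simp [add_comm]
  neg_add_cancel f := by ext n x; simp
  nsmul := nsmulRec
  zsmul := zsmulRec

/-- A projective resolution `⋯ → F₂ → F₁ → F₀ → B → 0` of a graded right `Λ`-module. -/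
structure ProjResolution {P : C} (B : GradedModule P) where
  F : ℕ → GradedModule P
  d : ∀ i : ℕ, GHom (F (i + 1)) (F i)
  aug : GHom (F 0) B
  projective : ∀ i, IsProjective (F i)
  aug_surjective : ∀ n : ℤ, Function.Surjective (aug.app n)
  exact_aug : ∀ (n : ℤ) (x : (F 0).M n), aug.app n x = 0 ↔ x ∈ Set.range ((d 0).app n)
  exact_d : ∀ (i : ℕ) (n : ℤ) (x : (F (i + 1)).M n),
    (d i).app n x = 0 ↔ x ∈ Set.range ((d (i + 1)).app n)

/-- The differential of the cochain complex `Hom_Λ(F_•, Z)` obtained by applying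
`Hom_Λ(−, Z)` to a projective resolution `F_•`. -/
def cochainD {P : C} {B : GradedModule P} (R : ProjResolution B) (Z : GradedModule P)
    (i : ℕ) : GHom (R.F i) Z →+ GHom (R.F (i + 1)) Z :=
  AddMonoidHom.mk' (fun f => f.comp (R.d i)) (fun f g => by ext n x; rfl)

/-- `Ext^{j+1}_Λ(B, Z)`, computed as the `(j+1)`-st cohomology
`ker(Hom(F_{j+1}, Z) → Hom(F_{j+2}, Z)) / im(Hom(F_j, Z) → Hom(F_{j+1}, Z))`
of the complex `Hom_Λ(F_•, Z)` for a projective resolution `F_• → B`. -/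
def extGroup {P : C} {B : GradedModule P} (R : ProjResolution B) (Z : GradedModule P)
    (j : ℕ) : Type v :=
  AddMonoidHom.ker (cochainD R Z (j + 1)) ⧸
    (AddMonoidHom.range (cochainD R Z j)).addSubgroupOf
      (AddMonoidHom.ker (cochainD R Z (j + 1)))

noncomputable instance {P : C} {B : GradedModule P} (R : ProjResolution B)
    (Z : GradedModule P) (j : ℕ) : AddCommGroup (extGroup R Z j) := by
  dsimp [extGroup]; infer_instance

end ExtGroups
section DG

/-- A differential graded right module over `Λ = End_T(P)_*`, where `Λ` is regarded as a
DG ring with zero differential: a graded right `Λ`-module together with a square-zero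
`Λ`-linear differential of degree `-1`. -/
structure DGMod (P : C) where
  gm : GradedModule P
  d : ∀ {n m : ℤ}, m + 1 = n → (gm.M n →+ gm.M m)
  d_sq : ∀ {n m j : ℤ} (h : m + 1 = n) (h' : j + 1 = m) (x : gm.M n), d h' (d h x) = 0
  d_smul : ∀ {n m j l l' : ℤ} (h : m + 1 = n) (hl : n + j = l) (hl' : l' + 1 = l)
    (hm : m + j = l') (x : gm.M n) (a : lam P j),
    d hl' (gm.smul hl x a) = gm.smul hm (d h x) a

/-- A morphism of DG `Λ`-modules: a morphism of the underlying graded modules commuting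
with the differentials. -/
structure DGHom {P : C} (M N : DGMod P) where
  g : GHom M.gm N.gm
  comm : ∀ {n m : ℤ} (h : m + 1 = n) (x : M.gm.M n),
    g.app m (M.d h x) = N.d h (g.app n x)

@[ext] theorem DGHom.ext {P : C} {M N : DGMod P} {f f' : DGHom M N}
    (h : ∀ (n : ℤ) (x : M.gm.M n), f.g.app n x = f'.g.app n x) : f = f' := by
  obtain ⟨fg, _⟩ := f; obtain ⟨fg', _⟩ := f'
  congr 1
  exact GHom.ext h

/-- The category of differential graded right `Λ`-modules. -/
instance dgModCategory (P : C) : Category (DGMod P) where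
  Hom M N := DGHom M N
  id M := ⟨GHom.id _, fun _ _ => rfl⟩
  comp f g := ⟨g.g.comp f.g, fun h x => by
    show g.g.app _ (f.g.app _ _) = _
    rw [f.comm, g.comm]
    rfl⟩
  id_comp f := by apply DGHom.ext; intros; rfl
  comp_id f := by apply DGHom.ext; intros; rfl
  assoc f g h := by apply DGHom.ext; intros; rfl

/-- The cycles `ker dₙ` of a DG module in degree `n`. -/
abbrev cycles {P : C} (M : DGMod P) (n : ℤ) : AddSubgroup (M.gm.M n) :=
  AddMonoidHom.ker (M.d (n := n) (m := n - 1) (by omega))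

/-- The boundaries `im d_{n+1}` of a DG module in degree `n`. -/
abbrev boundaries {P : C} (M : DGMod P) (n : ℤ) : AddSubgroup (M.gm.M n) :=
  AddMonoidHom.range (M.d (n := n + 1) (m := n) rfl)

/-- The homology `H_n M = ker dₙ / im d_{n+1}` of a DG module. -/
abbrev dgHomology {P : C} (M : DGMod P) (n : ℤ) : Type v :=
  cycles M n ⧸ (boundaries M n).addSubgroupOf (cycles M n)

/-- The map induced on cycles by a morphism of DG modules. -/
def cyclesMap {P : C} {M N : DGMod P} (f : M ⟶ N) (n : ℤ) : cycles M n →+ cycles N n :=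
  AddMonoidHom.codRestrict ((f.g.app n).comp (cycles M n).subtype) _ (fun x => by
    have hx : M.d (show (n - 1) + 1 = n by omega) x.1 = 0 := x.2
    have : N.d (show (n - 1) + 1 = n by omega) (f.g.app n x.1) = 0 := by
      rw [← f.comm (show (n - 1) + 1 = n by omega), hx, map_zero]
    exact this)

/-- The map induced on homology by a morphism of DG modules. -/
def dgHomologyMap {P : C} {M N : DGMod P} (f : M ⟶ N) (n : ℤ) :
    dgHomology M n →+ dgHomology N n :=
  QuotientAddGroup.map _ _ (cyclesMap f n) (by
    intro x hx
    have hx' : x.1 ∈ boundaries M n := hx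
    obtain ⟨y, hy⟩ := AddMonoidHom.mem_range.mp hx'
    have : (f.g.app n x.1) ∈ boundaries N n := by
      refine AddMonoidHom.mem_range.mpr ⟨f.g.app (n + 1) y, ?_⟩
      rw [← f.comm rfl y, hy]
    exact this)

/-- A quasi-isomorphism of DG modules: a morphism inducing an isomorphism on homology. -/
def quasiIso (P : C) : MorphismProperty (DGMod P) :=
  fun _ _ f => ∀ n : ℤ, Function.Bijective (dgHomologyMap f n)

/-- The derived category `D(Λ)` of the graded endomorphism ring `Λ = End_T(P)_*`
(regarded as a DG ring with zero differential): the localization of the category of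
DG right `Λ`-modules at the quasi-isomorphisms. -/
abbrev DerivedCat (P : C) := (quasiIso P).Localization

end DG


section SparseSplitting

/-- The element of `Λ` of degree `k - n` corresponding to a morphism `Σᵏ P ⟶ Σⁿ P`. -/
noncomputable def toLam (P : C) {k n : ℤ} (a : P⟦k⟧ ⟶ P⟦n⟧) : lam P (k - n) :=
  (shiftFunctor C n).preimage ((shiftFunctorAdd' C (k - n) n k (by omega)).inv.app P ≫ a)

theorem gsmulHom_comp (P : C) {X Y : C} {n k l : ℤ} (h : n + k = l) (m : P⟦n⟧ ⟶ X) (f : X ⟶ Y)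
    (a : lam P k) : gsmulHom P h (m ≫ f) a = gsmulHom P h m a ≫ f := by
  simp [gsmulHom]

theorem gsmulHom_toLam (P : C) {X : C} {k n : ℤ} (h : n + (k - n) = k) (m : P⟦n⟧ ⟶ X)
    (a : P⟦k⟧ ⟶ P⟦n⟧) : gsmulHom P h m (toLam P a) = a ≫ m := by
  simp [gsmulHom, toLam]

theorem gsmulHom_id_injective (P : C) {n j k : ℤ} (h : n + j = k) {a b : lam P j}
    (hab : gsmulHom P h (𝟙 (P⟦n⟧)) a = gsmulHom P h (𝟙 (P⟦n⟧)) b) : a = b := by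
  apply (shiftFunctor C n).map_injective
  simpa [gsmulHom] using hab

theorem toLam_gsmulHom (P : C) {n k j l : ℤ} (h : k + j = l) (h' : (k - n) + j = l - n)
    (a : P⟦k⟧ ⟶ P⟦n⟧) (b : lam P j) :
    toLam P (gsmulHom P h a b) = gmul P h' (toLam P a) b := by
  apply gsmulHom_id_injective P (n := n) (show n + (l - n) = l by omega)
  rw [gsmulHom_toLam, Category.comp_id]
  have := (piMod P (P⟦n⟧)).smul_mulₓ (show n + (k - n) = k by omega) h' h
    (show n + (l - n) = l by omega) (𝟙 _) (toLam P a) b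
  simp only [gsmulHom_toLam, Category.comp_id] at this
  exact this

theorem toLam_add (P : C) {k n : ℤ} (a b : P⟦k⟧ ⟶ P⟦n⟧) :
    toLam P (a + b) = toLam P a + toLam P b := by
  apply (shiftFunctor C n).map_injective
  simp [toLam, Functor.map_add]

theorem Sparse.shift_hom_eq_zero {P : C} {N : ℕ} (hsp : Sparse P N) {k n : ℤ}
    (h : (k : ZMod N) ≠ n) (a : P⟦k⟧ ⟶ P⟦n⟧) : a = 0 := by
  have h0 : toLam P a = 0 := by
    refine hsp _ (fun hd => h ?_) _
    exact ((ZMod.intCast_eq_intCast_iff_dvd_sub n k N).2 hd).symm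
  rw [← Category.comp_id a, ← gsmulHom_toLam P (by omega), h0]
  simp [gsmulHom]

/-- The map `Hom(Σᵏ P, Σⁿ P) → Aₖ` given by the action of `Λ` on an element of `Aₙ`. -/
noncomputable def GradedModule.orbitHom {P : C} (A : GradedModule P) {n : ℤ} (x : A.M n) (k : ℤ) :
    (P⟦k⟧ ⟶ P⟦n⟧) →+ A.M k :=
  AddMonoidHom.mk' (fun a => A.smul (by omega) x (toLam P a)) fun a b => by
    rw [toLam_add, A.smul_addₓ]

theorem GradedModule.smul_eq_self {P : C} (A : GradedModule P) {n j : ℤ} (h : n + j = n)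
    {a : lam P j} (ha : gsmulHom P h (𝟙 (P⟦n⟧)) a = 𝟙 _) (x : A.M n) : A.smul h x a = x := by
  obtain rfl : j = 0 := by omega
  obtain rfl : a = gone P :=
    gsmulHom_id_injective P h (ha.trans ((piMod P (P⟦n⟧)).smul_oneₓ (𝟙 _)).symm)
  exact A.smul_oneₓ x

/-- A graded submodule, given by a family of additive subgroups stable under the action. -/
@[reducible] def GradedModule.sub {P : C} (A : GradedModule P) (S : ∀ n, AddSubgroup (A.M n))
    (hS : ∀ {n k l : ℤ} (h : n + k = l) (m : A.M n) (a : lam P k), m ∈ S n → A.smul h m a ∈ S l) :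
    GradedModule P where
  M n := S n
  smul h m a := ⟨A.smul h m a, hS h m a m.2⟩
  smul_addₓ h m a b := Subtype.ext (A.smul_addₓ h m a b)
  add_smulₓ h m m' a := Subtype.ext (A.add_smulₓ h m m' a)
  smul_oneₓ m := Subtype.ext (A.smul_oneₓ m.1)
  smul_mulₓ h₁ h₂ h₃ h₄ m a b := Subtype.ext (A.smul_mulₓ h₁ h₂ h₃ h₄ m.1 a b)

/-- The kernel of a morphism of graded modules. -/
@[reducible] def GHom.ker {P : C} {A B : GradedModule P} (f : GHom A B) : GradedModule P :=
  A.sub (fun n => (f.app n).ker) fun h m a hm => by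
    rw [AddMonoidHom.mem_ker] at hm ⊢
    rw [f.app_smul, hm, B.zero_smulₓ]

/-- The inclusion of the kernel of a morphism of graded modules. -/
def GHom.kerι {P : C} {A B : GradedModule P} (f : GHom A B) : GHom f.ker A :=
  ⟨fun n => (f.app n).ker.subtype, fun _ _ _ => rfl⟩

/-- The factorization through the kernel of a morphism annihilated by `f`. -/
def GHom.kerLift {P : C} {A B D : GradedModule P} (f : GHom A B) (g : GHom D A)
    (h : ∀ n x, f.app n (g.app n x) = 0) : GHom D f.ker :=
  ⟨fun n => (g.app n).codRestrict _ (h n), fun _ _ _ => Subtype.ext (g.app_smul _ _ _)⟩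

/-- The image of a morphism of graded modules. -/
@[reducible] def GHom.range {P : C} {A B : GradedModule P} (f : GHom A B) : GradedModule P :=
  B.sub (fun n => (f.app n).range) fun h m a hm => by
    obtain ⟨x, rfl⟩ := hm
    exact ⟨A.smul h x a, f.app_smul h x a⟩

theorem GHom.congr_app {P : C} {A B : GradedModule P} {f g : GHom A B} (h : f = g) (n : ℤ)
    (x : A.M n) : f.app n x = g.app n x := by rw [h]

/-- A morphism from a projective module whose values lie in the image of `p` lifts along `p`. -/
theorem IsProjective.exists_lift {P : C} {F A B : GradedModule P} (hF : IsProjective F)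
    (p : GHom A B) (g : GHom F B) (h : ∀ n x, g.app n x ∈ (p.app n).range) :
    ∃ β : GHom F A, p.comp β = g := by
  obtain ⟨β, hβ⟩ := hF A p.range
    ⟨fun n => (p.app n).rangeRestrict, fun _ _ _ => Subtype.ext (p.app_smul _ _ _)⟩
    (fun n => (p.app n).rangeRestrict_surjective)
    ⟨fun n => (g.app n).codRestrict _ (h n), fun _ _ _ => Subtype.ext (g.app_smul _ _ _)⟩
  exact ⟨β, GHom.ext fun n x => congrArg Subtype.val (GHom.congr_app hβ n x)⟩

/-- A version of Schanuel's lemma: if `M` has projective dimension at most one and `p : E ⟶ M` is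
a morphism from a projective module onto the image of an endomorphism `τ` fixing that image,
then the kernel of `p` is projective. -/
theorem isProjective_ker {P : C} {M E : GradedModule P} (hM : projDimLE 1 M)
    (hE : IsProjective E) (p : GHom E M) (τ : GHom M M)
    (hτ : ∀ n x, τ.app n x ∈ (p.app n).range) (hτp : τ.comp p = p) : IsProjective p.ker := by
  obtain ⟨F, K, ε, ι, hF, hex, hK⟩ := hM
  obtain ⟨β, hβ⟩ := hF.exists_lift p (τ.comp ε) fun n x => hτ n _
  obtain ⟨α, hα⟩ := hE F M ε hex.epi p
  have hβ' (n : ℤ) (x : F.M n) : p.app n (β.app n x) = τ.app n (ε.app n x) :=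
    GHom.congr_app hβ n x
  have hα' (n : ℤ) (x : E.M n) : ε.app n (α.app n x) = p.app n x := GHom.congr_app hα n x
  have hτ' (n : ℤ) (x : E.M n) : τ.app n (p.app n x) = p.app n x := GHom.congr_app hτp n x
  have hιε (n : ℤ) (x : K.M n) : ε.app n (ι.app n x) = 0 := (hex.exact n _).2 ⟨x, rfl⟩
  let βK : GHom K p.ker := p.kerLift (β.comp ι) fun n x => by
    change p.app n (β.app n (ι.app n x)) = 0
    rw [hβ', hιε, map_zero]
  let r : GHom E p.ker := p.kerLift (GHom.id E + -(β.comp α)) fun n x => by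
    change p.app n (x + -(β.app n (α.app n x))) = 0
    rw [map_add, map_neg, hβ', hα', hτ', add_neg_cancel]
  have hαK (n : ℤ) (x : p.ker.M n) : ∃ y, ι.app n y = α.app n x.1 := by
    refine (hex.exact n _).1 ?_
    rw [hα']
    exact x.2
  choose a ha using hαK
  let αK : GHom p.ker K :=
    { app := fun n => AddMonoidHom.mk' (a n) fun x y => hex.mono n (by
        rw [map_add, ha, ha, ha]; exact map_add (α.app n) _ _)
      app_smul := fun h m b => hex.mono _ (by
        change ι.app _ (a _ _) = ι.app _ (K.smul h (a _ m) b)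
        rw [ha, ι.app_smul, ha]
        exact α.app_smul h m.1 b) }
  intro A B e he f
  obtain ⟨u, hu⟩ := hE A B e he (f.comp r)
  obtain ⟨w, hw⟩ := hK A B e he (f.comp βK)
  refine ⟨u.comp p.kerι + w.comp αK, GHom.ext fun n x => ?_⟩
  change e.app n (u.app n x.1 + w.app n (a n x)) = f.app n x
  have h1 : e.app n (u.app n x.1) = f.app n (r.app n x.1) := GHom.congr_app hu n x.1
  have h2 : e.app n (w.app n (a n x)) = f.app n (βK.app n (a n x)) := GHom.congr_app hw n _
  rw [map_add, h1, h2, ← map_add]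
  congr 1
  apply Subtype.ext
  change x.1 + -(β.app n (α.app n x.1)) + β.app n (ι.app n (a n x)) = x.1
  rw [ha, neg_add_cancel_right]

/-- The projection of a graded module onto its part in degrees congruent to `i` modulo `N`. -/
def Sparse.degreeProj {P : C} {N : ℕ} (hsp : Sparse P N) (A : GradedModule P) (i : ZMod N) :
    GHom A A where
  app n := if (n : ZMod N) = i then AddMonoidHom.id _ else 0
  app_smul {n k l} h m a := by
    by_cases hk : (N : ℤ) ∣ k
    · have : (l : ZMod N) = n := by
        rw [← h, Int.cast_add, (ZMod.intCast_zmod_eq_zero_iff_dvd k N).2 hk, add_zero]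
      rw [this]
      split_ifs
      · rfl
      · exact (A.zero_smulₓ h a).symm
    · obtain rfl := hsp k hk a
      have h0 (x : A.M n) : A.smul h x 0 = 0 := by
        have := A.smul_addₓ h x 0 0
        rwa [add_zero, left_eq_add] at this
      rw [h0, h0, map_zero]

/-- The Eilenberg swindle: an idempotent splits after adding an identity. -/
theorem exists_splitting_map_id [HasCoproducts.{v} C] {R : C} {f : R ⟶ R} (hf : f ≫ f = f) :
    ∃ (G : C) (φ : G ⟶ R ⊞ G) (ψ : R ⊞ G ⟶ G),
      φ ≫ ψ = 𝟙 G ∧ ψ ≫ φ = biprod.map f (𝟙 G) := by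
  have : HasCoproducts.{0} C := hasCoproducts_shrink.{0, v}
  let X : ℕ → C := fun _ => R
  obtain ⟨e, he⟩ : ∃ e, e = 𝟙 R - f := ⟨_, rfl⟩
  have hfe : f ≫ e = 0 := by simp [he, hf]
  have hef : e ≫ f = 0 := by simp [he, hf]
  have hee : e ≫ e = e := by
    nth_rw 2 [he]
    simp [hef]
  have hs : f + e = 𝟙 R := by simp [he]
  let φ : ∐ X ⟶ R ⊞ ∐ X := Sigma.desc fun n => match n with
    | 0 => f ≫ biprod.inl + e ≫ Sigma.ι X 0 ≫ biprod.inr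
    | n + 1 => f ≫ Sigma.ι X n ≫ biprod.inr + e ≫ Sigma.ι X (n + 1) ≫ biprod.inr
  let ψ : R ⊞ ∐ X ⟶ ∐ X := biprod.desc (f ≫ Sigma.ι X 0)
    (Sigma.desc fun n => e ≫ Sigma.ι X n + f ≫ Sigma.ι X (n + 1))
  have hφ0 : Sigma.ι X 0 ≫ φ = f ≫ biprod.inl + e ≫ Sigma.ι X 0 ≫ biprod.inr := by simp [φ]
  have hφS (n : ℕ) : Sigma.ι X (n + 1) ≫ φ =
      f ≫ Sigma.ι X n ≫ biprod.inr + e ≫ Sigma.ι X (n + 1) ≫ biprod.inr := by simp [φ]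
  have hψl : biprod.inl ≫ ψ = f ≫ Sigma.ι X 0 := by simp [ψ]
  have hψr (n : ℕ) : Sigma.ι X n ≫ biprod.inr ≫ ψ =
      e ≫ Sigma.ι X n + f ≫ Sigma.ι X (n + 1) := by simp [ψ]
  refine ⟨∐ X, φ, ψ, ?_, ?_⟩
  · refine Sigma.hom_ext _ _ fun n => ?_
    cases n with
    | zero =>
      rw [reassoc_of% hφ0]
      simp only [Preadditive.add_comp, Category.assoc, hψl, hψr, Preadditive.comp_add]
      rw [reassoc_of% hf, reassoc_of% hee, reassoc_of% hef, zero_comp, add_zero,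
        ← Preadditive.add_comp, hs, Category.id_comp, Category.comp_id]
    | succ n =>
      rw [reassoc_of% hφS]
      simp only [Preadditive.add_comp, Category.assoc, hψr, Preadditive.comp_add]
      rw [reassoc_of% hf, reassoc_of% hee, reassoc_of% hef, reassoc_of% hfe, zero_comp, zero_comp,
        add_zero, zero_add, ← Preadditive.add_comp, hs, Category.id_comp, Category.comp_id]
  · apply biprod.hom_ext'
    · rw [reassoc_of% hψl, hφ0]
      simp only [Preadditive.comp_add, biprod.inl_map]
      rw [reassoc_of% hf, reassoc_of% hfe, zero_comp, add_zero]
    · refine Sigma.hom_ext _ _ fun n => ?_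
      rw [reassoc_of% hψr]
      simp only [Preadditive.add_comp, Category.assoc, hφS, Preadditive.comp_add, biprod.inr_map,
        Category.id_comp]
      cases n with
      | zero =>
        rw [hφ0]
        simp only [Preadditive.comp_add]
        rw [reassoc_of% hef, reassoc_of% hee, reassoc_of% hf, reassoc_of% hfe, zero_comp, zero_comp,
          add_zero, zero_add, ← Preadditive.add_comp, add_comm e, hs, Category.id_comp]
      | succ n =>
        rw [hφS]
        simp only [Preadditive.comp_add]
        rw [reassoc_of% hef, reassoc_of% hee, reassoc_of% hf, reassoc_of% hfe, zero_comp, zero_comp,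
          add_zero, zero_add, ← Preadditive.add_comp, add_comm e, hs, Category.id_comp]

/-- A morphism injective on all `Hom(Σⁿ P, -)` remains so after shifting by one. -/
theorem comp_shift_injective {P G Z : C} {φ : G ⟶ Z}
    (h : ∀ (n : ℤ) (u : P⟦n⟧ ⟶ G), u ≫ φ = 0 → u = 0) {n : ℤ} (u : P⟦n⟧ ⟶ G⟦(1 : ℤ)⟧)
    (hu : u ≫ φ⟦(1 : ℤ)⟧' = 0) : u = 0 := by
  let i := (shiftFunctorAdd' C (n - 1) 1 n (by omega)).app P
  obtain ⟨w, hw⟩ := (shiftFunctor C (1 : ℤ)).map_surjective (i.inv ≫ u)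
  have hw0 : w = 0 := by
    refine h _ w ((shiftFunctor C (1 : ℤ)).map_injective ?_)
    rw [Functor.map_comp, hw, Category.assoc, hu, comp_zero, Functor.map_zero]
  rw [hw0, Functor.map_zero] at hw
  rw [← cancel_epi i.inv, ← hw, comp_zero]

section Coproducts

variable [HasCoproducts.{v} C]

theorem compactComparison_of (P : C) {ι : Type v} [DecidableEq ι] (X : ι → C) (i : ι)
    (f : P ⟶ X i) :
    compactComparison P X (DirectSum.of (fun i => P ⟶ X i) i f) = f ≫ Sigma.ι X i := by
  unfold compactComparison
  convert DirectSum.toAddMonoid_of _ _ _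
  rfl

theorem compactComparison_comp_π (P : C) {ι : Type v} [DecidableEq ι] (X : ι → C) (i : ι)
    (d : ⨁ i, (P ⟶ X i)) : compactComparison P X d ≫ Sigma.π X i = d i := by
  induction d using DirectSum.induction_on with
  | zero => simp
  | of j f =>
    rw [compactComparison_of, Category.assoc]
    by_cases h : j = i
    · subst h
      simp
    · rw [Sigma.ι_π_of_ne _ h, DirectSum.of_eq_of_ne _ _ _ (Ne.symm h), comp_zero]
  | add x y hx hy => simp [Preadditive.add_comp, hx, hy]

theorem compactComparison_injective (P : C) {ι : Type v} (X : ι → C) :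
    Function.Injective (compactComparison P X) := fun d d' h => by
  classical
  refine DFinsupp.ext fun i => ?_
  rw [← compactComparison_comp_π, ← compactComparison_comp_π, h]

theorem IsCompactObj.of_adjunction {P : C} (hP : IsCompactObj P) {F G : C ⥤ C} (adj : F ⊣ G)
    [F.Additive] [G.Additive] [∀ (ι : Type v) (X : ι → C), IsIso (sigmaComparison G X)] :
    IsCompactObj (F.obj P) := by
  classical
  refine fun ι X => ⟨compactComparison_injective _ _, fun u => ?_⟩
  have key : ∀ d : ⨁ i, (P ⟶ G.obj (X i)),
      ∃ d', compactComparison (F.obj P) X d' =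
        (adj.homEquiv P (∐ X)).symm
          (compactComparison P (fun i => G.obj (X i)) d ≫ sigmaComparison G X) := by
    intro d
    induction d using DirectSum.induction_on with
    | zero =>
      refine ⟨0, ?_⟩
      rw [map_zero, map_zero, zero_comp]
      exact (map_zero (adj.homAddEquiv P (∐ X)).symm).symm
    | of i f =>
      refine ⟨DirectSum.of (fun i => F.obj P ⟶ X i) i ((adj.homEquiv P (X i)).symm f), ?_⟩
      rw [compactComparison_of, compactComparison_of, Category.assoc, ι_comp_sigmaComparison]
      exact (adj.homEquiv_naturality_right_symm f (Sigma.ι X i)).symm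
    | add x y hx hy =>
      obtain ⟨x', hx⟩ := hx
      obtain ⟨y', hy⟩ := hy
      refine ⟨x' + y', ?_⟩
      rw [map_add, map_add, Preadditive.add_comp, hx, hy]
      exact (map_add (adj.homAddEquiv P (∐ X)).symm _ _).symm
  obtain ⟨d, hd⟩ := (hP ι fun i => G.obj (X i)).2
    (adj.homEquiv P (∐ X) u ≫ inv (sigmaComparison G X))
  obtain ⟨d', hd'⟩ := key d
  refine ⟨d', ?_⟩
  rw [hd', hd]
  simp

theorem IsCompactObj.shift {P : C} (hP : IsCompactObj P) (k : ℤ) : IsCompactObj (P⟦k⟧) :=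
  haveI (ι : Type v) (X : ι → C) : IsIso (sigmaComparison (shiftFunctor C (-k)) X) :=
    inferInstance
  IsCompactObj.of_adjunction hP
    (show shiftFunctor C k ⊣ shiftFunctor C (-k) from (shiftEquiv C k).toAdjunction)

/-- The comparison map of a compact object as an additive equivalence. -/
noncomputable def IsCompactObj.comparisonEquiv {P : C} (hP : IsCompactObj P) {ι : Type v}
    (X : ι → C) : (⨁ i, (P ⟶ X i)) ≃+ (P ⟶ ∐ X) :=
  AddEquiv.ofBijective (compactComparison P X) (hP ι X)

/-- Morphisms out of a compact object into a coproduct are sums of morphisms into summands. -/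
theorem IsCompactObj.hom_induction {P : C} (hP : IsCompactObj P) {ι : Type v} {X : ι → C}
    {p : (P ⟶ ∐ X) → Prop} (zero : p 0) (of : ∀ i (f : P ⟶ X i), p (f ≫ Sigma.ι X i))
    (add : ∀ f g, p f → p g → p (f + g)) (u : P ⟶ ∐ X) : p u := by
  classical
  obtain ⟨d, rfl⟩ := (hP ι X).2 u
  induction d using DirectSum.induction_on with
  | zero => simpa using zero
  | of i f => rw [compactComparison_of]; exact of i f
  | add x y hx hy => rw [map_add]; exact add _ _ hx hy

/-- The coproduct of the shifts `Σⁿ⁽ˢ⁾ P`. -/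
noncomputable abbrev freeObj (P : C) {S : Type v} (n : S → ℤ) : C := ∐ fun s => P⟦n s⟧

/-- The basis element of `π_* (∐ Σⁿ⁽ˢ⁾ P)` indexed by `s`. -/
noncomputable abbrev freeι (P : C) {S : Type v} (n : S → ℤ) (s : S) : P⟦n s⟧ ⟶ freeObj P n :=
  Sigma.ι (fun s => P⟦n s⟧) s

theorem Sparse.freeObj_hom_eq_zero {P : C} {N : ℕ} (hsp : Sparse P N) (hP : IsCompactObj P)
    {S : Type v} {n : S → ℤ} {i : ZMod N} (hn : ∀ s, (n s : ZMod N) = i) {k : ℤ}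
    (hk : (k : ZMod N) ≠ i) (u : P⟦k⟧ ⟶ freeObj P n) : u = 0 := by
  induction u using (hP.shift k).hom_induction with
  | zero => rfl
  | of s f => rw [hsp.shift_hom_eq_zero (by rwa [hn]) f, zero_comp]
  | add f g hf hg => rw [hf, hg, add_zero]

theorem GHom.app_comp_eq {P Y : C} {A : GradedModule P} (g : GHom (piMod P Y) A) {k n : ℤ}
    (f : P⟦k⟧ ⟶ P⟦n⟧) (m : P⟦n⟧ ⟶ Y) : g.app k (f ≫ m) = A.orbitHom (g.app n m) k f := by
  rw [← gsmulHom_toLam P (by omega)]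
  exact g.app_smul _ m (toLam P f)

theorem freeObj_ghom_ext {P : C} (hP : IsCompactObj P) {S : Type v} {n : S → ℤ}
    {A : GradedModule P} {g g' : GHom (piMod P (freeObj P n)) A}
    (h : ∀ s, g.app (n s) (freeι P n s) = g'.app (n s) (freeι P n s)) : g = g' := by
  ext k u
  induction u using (hP.shift k).hom_induction with
  | zero => exact (map_zero (g.app k)).trans (map_zero (g'.app k)).symm
  | of s f => rw [g.app_comp_eq, g'.app_comp_eq, h]
  | add f f' hf hf' =>
    exact (map_add (g.app k) f f').trans (by rw [hf, hf']; exact (map_add (g'.app k) f f').symm)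

/-- `π_*` of a coproduct of shifts of a compact object `P` is a free graded module. -/
theorem exists_freeObj_ghom {P : C} (hP : IsCompactObj P) {S : Type v} {n : S → ℤ}
    (A : GradedModule P) (a : ∀ s, A.M (n s)) :
    ∃ g : GHom (piMod P (freeObj P n)) A, ∀ s, g.app (n s) (freeι P n s) = a s := by
  classical
  let app (k : ℤ) : (P⟦k⟧ ⟶ freeObj P n) →+ A.M k :=
    (DirectSum.toAddMonoid fun s => A.orbitHom (a s) k).comp
      ((hP.shift k).comparisonEquiv fun s => P⟦n s⟧).symm.toAddMonoidHom
  have happ (k : ℤ) (s : S) (f : P⟦k⟧ ⟶ P⟦n s⟧) :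
      app k (f ≫ freeι P n s) = A.orbitHom (a s) k f := by
    have : ((hP.shift k).comparisonEquiv fun s => P⟦n s⟧).symm (f ≫ freeι P n s) =
        DirectSum.of (fun s => P⟦k⟧ ⟶ P⟦n s⟧) s f := by
      rw [AddEquiv.symm_apply_eq]
      exact (compactComparison_of (P⟦k⟧) (fun s => P⟦n s⟧) s f).symm
    change DirectSum.toAddMonoid _ (((hP.shift k).comparisonEquiv fun s => P⟦n s⟧).symm _) = _
    rw [this, DirectSum.toAddMonoid_of]
  refine ⟨⟨app, ?_⟩, fun s => ?_⟩
  · intro k j l h m b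
    induction m using (hP.shift k).hom_induction with
    | zero =>
      rw [(piMod P (freeObj P n)).zero_smulₓ, map_zero, map_zero, A.zero_smulₓ]
    | of s f =>
      change app l (gsmulHom P h (f ≫ freeι P n s) b) = A.smul h (app k (f ≫ freeι P n s)) b
      rw [gsmulHom_comp, happ, happ]
      change A.smul _ (a s) (toLam P _) = A.smul h (A.smul _ (a s) (toLam P f)) b
      rw [toLam_gsmulHom P h (by omega)]
      exact (A.smul_mulₓ _ _ _ _ _ _ _).symm
    | add f f' hf hf' =>
      rw [(piMod P (freeObj P n)).add_smulₓ, map_add, map_add, A.add_smulₓ, hf, hf']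
  · have := happ (n s) s (𝟙 _)
    rw [Category.id_comp] at this
    refine this.trans ?_
    refine A.smul_eq_self _ ?_ _
    rw [gsmulHom_toLam, Category.comp_id]

theorem isProjective_freeObj {P : C} (hP : IsCompactObj P) {S : Type v} (n : S → ℤ) :
    IsProjective (piMod P (freeObj P n)) := by
  intro A B e he f
  choose a ha using fun s => he (n s) (f.app (n s) (freeι P n s))
  obtain ⟨g, hg⟩ := exists_freeObj_ghom hP A a
  refine ⟨g, freeObj_ghom_ext hP fun s => ?_⟩
  change e.app _ (g.app _ _) = _
  rw [hg, ha]

end Coproducts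

/-- The part of `X` in degrees congruent to `i`: an object over `X` realizing the corresponding
summand of `π_* X`. -/
theorem exists_degree_part [HasCoproducts.{v} C] {P : C} (hP : IsCompactObj P) {N : ℕ}
    (hsp : Sparse P N) {X : C} (hX : projDimLE 1 (piMod P X)) (i : ZMod N) :
    ∃ (Y : C) (d : Y ⟶ X), InDegrees N i (piMod P Y) ∧
      (∀ (n : ℤ) (u : P⟦n⟧ ⟶ Y), u ≫ d = 0 → u = 0) ∧
      ∀ n : ℤ, (n : ZMod N) = i → ∀ x : P⟦n⟧ ⟶ X, ∃ y : P⟦n⟧ ⟶ Y, y ≫ d = x := by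
  let S := {s : Σ n : ℤ, (P⟦n⟧ ⟶ X) // (s.1 : ZMod N) = i}
  let Q := freeObj P fun s : S => s.1.1
  let p : Q ⟶ X := Sigma.desc fun s : S => s.1.2
  have hQ {k : ℤ} (hk : (k : ZMod N) ≠ i) (u : P⟦k⟧ ⟶ Q) : u = 0 :=
    hsp.freeObj_hom_eq_zero hP (fun s => s.2) hk u
  have hp (n : ℤ) (hn : (n : ZMod N) = i) (x : P⟦n⟧ ⟶ X) : ∃ q : P⟦n⟧ ⟶ Q, q ≫ p = x :=
    ⟨freeι P (fun s : S => s.1.1) ⟨⟨n, x⟩, hn⟩, Sigma.ι_desc _ _⟩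
  have hK : IsProjective (piGHom P p).ker := by
    refine isProjective_ker hX (isProjective_freeObj hP _) _ (hsp.degreeProj _ i) ?_ ?_
    · intro n x
      change (if (n : ZMod N) = i then AddMonoidHom.id _ else 0 : (P⟦n⟧ ⟶ X) →+ _) x ∈ _
      split_ifs with hn
      · exact hp n hn x
      · exact zero_mem _
    · ext n (x : P⟦n⟧ ⟶ Q)
      change (if (n : ZMod N) = i then AddMonoidHom.id _ else 0 : (P⟦n⟧ ⟶ X) →+ _) (x ≫ p) = x ≫ p
      split_ifs with hn
      · rfl
      · rw [hQ hn x, zero_comp, map_zero]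
  let T := {t : Σ n : ℤ, (P⟦n⟧ ⟶ Q) // t.2 ≫ p = 0}
  let R := freeObj P fun t : T => t.1.1
  let r : R ⟶ Q := Sigma.desc fun t : T => t.1.2
  have hrp : r ≫ p = 0 := Sigma.hom_ext _ _ fun t => by simpa [r] using t.2
  obtain ⟨s, hs⟩ := hK (piMod P R) _
    ((piGHom P p).kerLift (piGHom P r) fun n (x : P⟦n⟧ ⟶ R) => by
      change (x ≫ r) ≫ p = 0
      rw [Category.assoc, hrp, comp_zero])
    (fun n q => ⟨freeι P (fun t : T => t.1.1) ⟨⟨n, q.1⟩, q.2⟩,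
      Subtype.ext (Sigma.ι_desc _ _)⟩) (GHom.id _)
  let s' (n : ℤ) (q : P⟦n⟧ ⟶ Q) (hq : q ≫ p = 0) : P⟦n⟧ ⟶ R := s.app n ⟨q, hq⟩
  have hs' (n : ℤ) (q : P⟦n⟧ ⟶ Q) (hq : q ≫ p = 0) : s' n q hq ≫ r = q :=
    congrArg Subtype.val (GHom.congr_app hs n ⟨q, hq⟩)
  let f : R ⟶ R := Sigma.desc fun t : T => s' t.1.1 t.1.2 t.2
  have hι (t : T) : freeι P (fun t : T => t.1.1) t ≫ r = t.1.2 := Sigma.ι_desc _ _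
  have hιf (t : T) : freeι P (fun t : T => t.1.1) t ≫ f = s' t.1.1 t.1.2 t.2 := Sigma.ι_desc _ _
  have hpf : piGHom P f = s.comp ((piGHom P p).kerLift (piGHom P r) fun n (x : P⟦n⟧ ⟶ R) => by
      change (x ≫ r) ≫ p = 0
      rw [Category.assoc, hrp, comp_zero]) := by
    refine freeObj_ghom_ext hP fun t => ?_
    change freeι P (fun t : T => t.1.1) t ≫ f = s' _ (freeι P (fun t : T => t.1.1) t ≫ r) _
    rw [hιf]
    congr 1
    exact (hι t).symm
  have hf (n : ℤ) (x : P⟦n⟧ ⟶ R) :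
      x ≫ f = s' n (x ≫ r) (by rw [Category.assoc, hrp, comp_zero]) := GHom.congr_app hpf n x
  have hfr : f ≫ r = r := Sigma.hom_ext _ _ fun t => by
    rw [reassoc_of% (hιf t), hs']
    exact (hι t).symm
  have hff : f ≫ f = f := Sigma.hom_ext _ _ fun t => by
    rw [reassoc_of% (hιf t), hf]
    simp only [hs']
    exact (hιf t).symm
  have hfinj (n : ℤ) (x : P⟦n⟧ ⟶ R) (hx : x ≫ r = 0) : x ≫ f = 0 := by
    rw [hf]
    simp only [hx]
    exact map_zero (s.app n)
  obtain ⟨G, φ, ψ, hφψ, hψφ⟩ := exists_splitting_map_id hff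
  let j : G ⟶ Q ⊞ G := φ ≫ biprod.map r (𝟙 G)
  let c : Q ⊞ G ⟶ X := biprod.desc p 0
  have hφf : φ ≫ biprod.map f (𝟙 G) = φ := by rw [← hψφ, reassoc_of% hφψ]
  have hjc : j ≫ c = 0 := by
    have : biprod.map r (𝟙 G) ≫ c = 0 := by
      apply biprod.hom_ext' <;> simp [c, hrp]
    rw [Category.assoc, this, comp_zero]
  have hj (n : ℤ) (u : P⟦n⟧ ⟶ G) (hu : u ≫ j = 0) : u = 0 := by
    have h1 : (u ≫ φ ≫ biprod.fst) ≫ r = 0 := by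
      simpa [j] using congrArg (· ≫ biprod.fst) hu
    have h2 : u ≫ φ ≫ biprod.snd = 0 := by
      simpa [j] using congrArg (· ≫ biprod.snd) hu
    have h3 : u ≫ φ = 0 := by
      rw [← hφf]
      apply biprod.hom_ext
      · simpa using hfinj n _ h1
      · simpa using h2
    rw [← Category.comp_id u, ← hφψ, reassoc_of% h3, zero_comp]
  have hjexact (n : ℤ) (v : P⟦n⟧ ⟶ Q ⊞ G) (hv : v ≫ c = 0) : ∃ w, w ≫ j = v := by
    have hv1 : (v ≫ biprod.fst) ≫ p = 0 := by
      rw [← hv]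
      simp [c, biprod.desc_eq]
    refine ⟨biprod.lift (s' n _ hv1) (v ≫ biprod.snd) ≫ ψ, ?_⟩
    rw [Category.assoc, reassoc_of% hψφ]
    apply biprod.hom_ext
    · simp [hfr, hs']
    · simp
  obtain ⟨Y, g, δ, hT⟩ := distinguished_cocone_triangle j
  obtain ⟨(d : Y ⟶ X), (hd : c = g ≫ d)⟩ := Triangle.yoneda_exact₂ _ hT c hjc
  have hjg : j ≫ g = 0 := comp_distTriang_mor_zero₁₂ _ hT
  have hδj : δ ≫ j⟦(1 : ℤ)⟧' = 0 := comp_distTriang_mor_zero₃₁ _ hT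
  have hg (n : ℤ) (u : P⟦n⟧ ⟶ Y) : ∃ v : P⟦n⟧ ⟶ Q ⊞ G, u = v ≫ g := by
    refine Triangle.coyoneda_exact₃ _ hT u (comp_shift_injective hj (u ≫ δ) ?_)
    rw [Category.assoc, hδj, comp_zero]
  have hdinj (n : ℤ) (u : P⟦n⟧ ⟶ Y) (hu : u ≫ d = 0) : u = 0 := by
    obtain ⟨v, rfl⟩ := hg n u
    rw [Category.assoc, ← hd] at hu
    obtain ⟨w, rfl⟩ := hjexact n v hu
    rw [Category.assoc, hjg, comp_zero]
  refine ⟨Y, d, fun n hn (u : P⟦n⟧ ⟶ Y) => hdinj n u ?_, hdinj, fun n hn x => ?_⟩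
  · obtain ⟨v, rfl⟩ := hg n u
    rw [Category.assoc, ← hd]
    simp only [c, biprod.desc_eq, comp_zero, add_zero]
    rw [← Category.assoc, hQ hn (v ≫ biprod.fst), zero_comp]
  · obtain ⟨q, rfl⟩ := hp n hn x
    exact ⟨q ≫ biprod.inl ≫ g, by simp [← hd, c]⟩

/-- A morphism inducing an isomorphism on `π_*` is an isomorphism if `P` is a generator. -/
theorem IsGenerator.isIso {P : C} (hgen : IsGenerator P) {X Y : C} (f : X ⟶ Y)
    (hinj : ∀ (n : ℤ) (u : P⟦n⟧ ⟶ X), u ≫ f = 0 → u = 0)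
    (hsurj : ∀ (n : ℤ) (y : P⟦n⟧ ⟶ Y), ∃ x, x ≫ f = y) : IsIso f := by
  obtain ⟨Z, g, δ, hT⟩ := distinguished_cocone_triangle f
  have hfg : f ≫ g = 0 := comp_distTriang_mor_zero₁₂ _ hT
  have hδf : δ ≫ f⟦(1 : ℤ)⟧' = 0 := comp_distTriang_mor_zero₃₁ _ hT
  refine (Triangle.isZero₃_iff_isIso₁ _ hT).1 (hgen _ fun n (u : P⟦n⟧ ⟶ Z) => ?_)
  obtain ⟨(v : P⟦n⟧ ⟶ Y), (rfl : u = v ≫ g)⟩ := Triangle.coyoneda_exact₃ _ hT u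
    (comp_shift_injective hinj (u ≫ δ) (by rw [Category.assoc, hδf, comp_zero]))
  obtain ⟨w, rfl⟩ := hsurj n v
  rw [Category.assoc, hfg, comp_zero]
  rfl

end SparseSplitting

/-- Let `P` be a compact generator of the triangulated category `C`
with `Λ` `N`-sparse. Then every object `X` with `proj dim π_* X ≤ 1` splits as a
coproduct `X ≅ ∐_{i ∈ ℤ/N} X⁽ⁱ⁾` with `π_* X⁽ⁱ⁾ ∈ B[i]` for each `i`. -/
theorem statement_7 [IsTriangulated C] [HasCoproducts.{v} C] [HasFiniteCoproducts C]
    (P : C) (hcpt : IsCompactObj P) (hgen : IsGenerator P)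
    (N : ℕ) (hN : 2 ≤ N) (hsp : Sparse P N)
    (X : C) (hX : projDimLE 1 (piMod P X)) :
    ∃ Xf : Fin N → C,
      (∀ j : Fin N, InDegrees N ((j : ℕ) : ZMod N) (piMod P (Xf j))) ∧
      Nonempty (X ≅ ∐ Xf) := by
  have : NeZero N := ⟨by omega⟩
  choose Xf d hdeg hinj hsurj using fun j : Fin N =>
    exists_degree_part hcpt hsp hX ((j : ℕ) : ZMod N)
  refine ⟨Xf, hdeg, ⟨(?_ : ∐ Xf ≅ X).symm⟩⟩
  have htotal : ∑ j, Sigma.π Xf j ≫ Sigma.ι Xf j = 𝟙 (∐ Xf) := by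
    refine Sigma.hom_ext _ _ fun k => ?_
    rw [Preadditive.comp_sum, Finset.sum_eq_single k]
    · simp
    · intro j _ hj
      rw [Sigma.ι_π_of_ne_assoc _ hj.symm, zero_comp]
    · simp
  have key (n : ℤ) : ∃ j : Fin N, ((j : ℕ) : ZMod N) = n ∧
      ∀ u : P⟦n⟧ ⟶ ∐ Xf, u = (u ≫ Sigma.π Xf j) ≫ Sigma.ι Xf j := by
    refine ⟨⟨(n : ZMod N).val, ZMod.val_lt _⟩, ZMod.natCast_zmod_val _, fun u => ?_⟩
    nth_rw 1 [← Category.comp_id u, ← htotal]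
    rw [Preadditive.comp_sum, Finset.sum_eq_single ⟨(n : ZMod N).val, ZMod.val_lt _⟩]
    · rw [Category.assoc]
    · intro k _ hk
      rw [← Category.assoc, hdeg k n (fun h => hk ?_) (u ≫ Sigma.π Xf k), zero_comp]
      exact Fin.ext ((ZMod.val_natCast_of_lt k.2).symm.trans (congrArg ZMod.val h.symm))
    · simp
  have : IsIso (Sigma.desc d) := by
    refine hgen.isIso _ (fun n u hu => ?_) fun n x => ?_
    · obtain ⟨j, -, hj⟩ := key n
      rw [hj u, Category.assoc, Sigma.ι_desc] at hu
      rw [hj u, hinj j n _ hu, zero_comp]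
    · obtain ⟨j, hj, -⟩ := key n
      obtain ⟨y, hy⟩ := hsurj j n hj.symm x
      exact ⟨y ≫ Sigma.ι Xf j, by rw [Category.assoc, Sigma.ι_desc, hy]⟩
  exact asIso (Sigma.desc d)

end Franke
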